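/- For every integer n ≥ 1, the cardinality of the approximate unit circle C(n) equals |C(n)| = 8n − 4·∑_{d | n², d odd} (−1)^{(d−1)/2}, where the sum ranges over all odd positive divisors d = 2e + 1 of n² and the summand is (−1)^e. -/

import Mathlib

open Real Set Filter

/-- The open interior of the box `B_{i,j}(n) = [i/n,(i+1)/n] × [j/n,(j+1)/n]`. -/
def boxInt (n : ℕ) (i j : ℤ) : Set (ℝ × ℝ) :=
  {p | (i : ℝ) / n < p.1 ∧ p.1 < ((i : ℝ) + 1) / n ∧
       (j : ℝ) / n < p.2 ∧ p.2 < ((j : ℝ) + 1) / n}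

/-- The plane unit circle `C`. -/
def unitCircle : Set (ℝ × ℝ) := {p | p.1 ^ 2 + p.2 ^ 2 = 1}

/-- The approximation `X(n)` of a set `X ⊆ ℝ²`: the boxes (encoded by their index
pairs `(i,j) ∈ ℤ²`) whose open interior intersects `X`. -/
def approx (n : ℕ) (X : Set (ℝ × ℝ)) : Set (ℤ × ℤ) :=
  {ij | (boxInt n ij.1 ij.2 ∩ X).Nonempty}

/-- Sum of `χ₄` over divisors. -/
def chiSum (m : ℕ) : ℤ := ∑ d ∈ m.divisors, ZMod.χ₄ (d : ZMod 4)

/-- Hecke-type recursion. -/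
def HeckeRec (F : ℕ → ℤ) : Prop :=
  ∀ p m : ℕ, p.Prime → 0 < m →
    F (p * m) = (1 + ZMod.χ₄ (p : ZMod 4)) * F m
      - ZMod.χ₄ (p : ZMod 4) * (if p ∣ m then F (m / p) else 0)

lemma hecke_unique (F G : ℕ → ℤ) (hF : HeckeRec F) (hG : HeckeRec G) (c : ℤ)
    (h1 : F 1 = c * G 1) : ∀ m : ℕ, 0 < m → F m = c * G m := by
  intro m
  induction m using Nat.strong_induction_on with
  | _ m ih =>
    intro hm
    by_cases hm1 : m = 1
    · subst hm1; exact h1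
    · obtain ⟨p, hp, k, rfl⟩ := Nat.exists_prime_and_dvd hm1
      have hk : 0 < k := Nat.pos_of_mul_pos_left hm
      have hlt : k < p * k := by nlinarith [hp.two_le]
      rw [hF p k hp hk, hG p k hp hk, ih k hlt hk]
      split_ifs with h
      · have h2 : 0 < k / p := Nat.div_pos (Nat.le_of_dvd hk h) hp.pos
        rw [ih (k / p) (lt_of_le_of_lt (Nat.div_le_self _ _) hlt) h2]
        ring
      · ring

lemma hecke_chiSum : HeckeRec chiSum := by
  intro p m hp hm
  unfold chiSum
  have hinj : Function.Injective (fun d : ℕ => p * d) :=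
    fun a b h => Nat.eq_of_mul_eq_mul_left hp.pos h
  have hsum : ∀ k : ℕ, ∑ d ∈ (k.divisors.image (fun d : ℕ => p * d)), ZMod.χ₄ (d : ZMod 4)
      = ZMod.χ₄ (p : ZMod 4) * ∑ d ∈ k.divisors, ZMod.χ₄ (d : ZMod 4) := by
    intro k
    rw [Finset.sum_image (fun a _ b _ h => hinj h), Finset.mul_sum]
    refine Finset.sum_congr rfl fun d _ => ?_
    push_cast
    rw [map_mul]
  have hU : (p * m).divisors = m.divisors ∪ m.divisors.image (fun d : ℕ => p * d) := by
    ext d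
    simp only [Nat.mem_divisors, Finset.mem_union, Finset.mem_image]
    constructor
    · rintro ⟨hd, -⟩
      by_cases hpd : p ∣ d
      · obtain ⟨e, rfl⟩ := hpd
        exact Or.inr ⟨e, ⟨Nat.dvd_of_mul_dvd_mul_left hp.pos hd, hm.ne'⟩, rfl⟩
      · exact Or.inl ⟨((hp.coprime_iff_not_dvd.2 hpd).symm).dvd_of_dvd_mul_left hd, hm.ne'⟩
    · have h0 : p * m ≠ 0 := mul_ne_zero hp.ne_zero hm.ne'
      rintro (⟨h, -⟩ | ⟨e, ⟨h, -⟩, rfl⟩)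
      · exact ⟨h.mul_left p, h0⟩
      · exact ⟨Nat.mul_dvd_mul_left p h, h0⟩
  have hI : ∑ d ∈ m.divisors ∩ m.divisors.image (fun d : ℕ => p * d), ZMod.χ₄ (d : ZMod 4)
      = ZMod.χ₄ (p : ZMod 4) *
        (if p ∣ m then ∑ d ∈ (m / p).divisors, ZMod.χ₄ (d : ZMod 4) else 0) := by
    split_ifs with h
    · rw [← hsum]
      congr 1
      obtain ⟨k, rfl⟩ := h
      rw [Nat.mul_div_cancel_left _ hp.pos]
      have hk : k ≠ 0 := (Nat.pos_of_mul_pos_left hm).ne'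
      ext d
      simp only [Nat.mem_divisors, Finset.mem_inter, Finset.mem_image]
      constructor
      · rintro ⟨⟨h, -⟩, e, -, rfl⟩
        exact ⟨e, ⟨Nat.dvd_of_mul_dvd_mul_left hp.pos h, hk⟩, rfl⟩
      · rintro ⟨e, ⟨h, -⟩, rfl⟩
        exact ⟨⟨Nat.mul_dvd_mul_left p h, hm.ne'⟩, e, ⟨h.mul_left p, hm.ne'⟩, rfl⟩
    · rw [mul_zero]
      apply Finset.sum_eq_zero
      intro d hd
      exfalso
      simp only [Nat.mem_divisors, Finset.mem_inter, Finset.mem_image] at hd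
      obtain ⟨⟨h1, -⟩, e, -, rfl⟩ := hd
      exact h (dvd_of_mul_right_dvd h1)
  have := Finset.sum_union_inter (s₁ := m.divisors) (s₂ := m.divisors.image (fun d : ℕ => p * d))
    (f := fun d : ℕ => ZMod.χ₄ (d : ZMod 4))
  rw [← hU, hI, hsum] at this
  linarith

lemma chiSum_eq (m : ℕ) :
    ∑ d ∈ m.divisors.filter (fun d => Odd d), (-1 : ℤ) ^ ((d - 1) / 2) = chiSum m := by
  unfold chiSum
  rw [Finset.sum_filter]
  refine Finset.sum_congr rfl fun d _ => ?_
  split_ifs with h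
  · rw [ZMod.χ₄_eq_neg_one_pow (Nat.odd_iff.1 h)]
    congr 1
    obtain ⟨k, rfl⟩ := h
    omega
  · rw [ZMod.χ₄_nat_eq_if_mod_four, if_pos]
    simpa [Nat.odd_iff] using h

/-- Gaussian integers of norm `m`. -/
def gaussNorm (m : ℕ) : Set GaussianInt := {z | Zsqrtd.norm z = (m : ℤ)}

lemma gaussNorm_iff (m : ℕ) (z : GaussianInt) :
    z ∈ gaussNorm m ↔ z.re ^ 2 + z.im ^ 2 = (m : ℤ) := by
  simp only [gaussNorm, Set.mem_ofPred_eq, Zsqrtd.norm_def]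
  constructor <;> intro h <;> linarith

lemma gaussNorm_finite (m : ℕ) : (gaussNorm m).Finite := by
  apply Set.Finite.subset (((Set.finite_Icc (-(m : ℤ)) m).prod
    (Set.finite_Icc (-(m : ℤ)) m)).image (fun q : ℤ × ℤ => (⟨q.1, q.2⟩ : GaussianInt)))
  intro z hz
  rw [gaussNorm_iff] at hz
  have key : ∀ x y : ℤ, x ^ 2 + y ^ 2 = (m : ℤ) → -(m : ℤ) ≤ x ∧ x ≤ m := by
    intro x y h
    constructor
    · nlinarith [sq_nonneg y, Int.le_self_sq (-x)]
    · nlinarith [sq_nonneg y, Int.le_self_sq x]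
  refine ⟨(z.re, z.im), ⟨?_, ?_⟩, rfl⟩
  · exact key _ _ hz
  · exact key _ z.re (by linarith)

lemma gauss_ncard_mul (a : GaussianInt) (ha : a ≠ 0) (S : Set GaussianInt) :
    ((fun z => a * z) '' S).ncard = S.ncard :=
  Set.ncard_image_of_injective _ (fun _ _ h => mul_left_cancel₀ ha h)

lemma gauss_star_dvd {a z : GaussianInt} (h : a ∣ star z) : star a ∣ z := by
  obtain ⟨c, hc⟩ := h
  refine ⟨star c, ?_⟩
  rw [← star_star z, hc, star_mul']

lemma gauss_prime_of_norm {a : GaussianInt} {p : ℕ} (hp : p.Prime)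
    (h : Zsqrtd.norm a = (p : ℤ)) : Prime a := by
  rw [← irreducible_iff_prime]
  have hun : ∀ b : GaussianInt, IsUnit b ↔ (Zsqrtd.norm b).natAbs = 1 :=
    fun b => Zsqrtd.norm_eq_one_iff.symm
  constructor
  · rw [hun, h]
    simpa using hp.ne_one
  · intro b c hbc
    rw [hun, hun]
    have : p = (Zsqrtd.norm b).natAbs * (Zsqrtd.norm c).natAbs := by
      rw [← Int.natAbs_mul, ← Zsqrtd.norm_mul, ← hbc, h]; simp
    rcases (Nat.dvd_prime hp).1 ⟨_, this⟩ with h1 | h1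
    · exact Or.inl h1
    · right
      rw [h1] at this
      have := hp.pos
      nlinarith

lemma gauss_two (m : ℕ) : (gaussNorm (2 * m)).ncard = (gaussNorm m).ncard := by
  have ha : (⟨1, 1⟩ : GaussianInt) ≠ 0 := by
    intro h; simpa using congrArg Zsqrtd.re h
  rw [← gauss_ncard_mul ⟨1, 1⟩ ha (gaussNorm m)]
  congr 1
  ext ⟨x, y⟩
  simp only [Set.mem_image, gaussNorm_iff]
  constructor
  · intro h
    push_cast at h
    have h2 : Even (x ^ 2 + y ^ 2) := ⟨m, by linarith⟩
    have h3 : Even (x + y) := by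
      rw [Int.even_add, Int.even_pow' two_ne_zero, Int.even_pow' two_ne_zero] at h2
      rwa [Int.even_add]
    obtain ⟨k, hk⟩ := h3
    have hx : x = k + k - y := by linarith
    subst hx
    refine ⟨⟨k, y - k⟩, ?_, ?_⟩
    · simp only; nlinarith
    · ext <;> simp <;> ring
  · rintro ⟨w, hw, he⟩
    have h1 := congrArg Zsqrtd.re he
    have h2 := congrArg Zsqrtd.im he
    simp at h1 h2
    push_cast
    rw [← h1, ← h2]
    linear_combination 2 * hw

lemma gauss_three {p : ℕ} (hp : p.Prime) (h3 : p % 4 = 3) (m : ℕ) :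
    (gaussNorm (p * m)).ncard = if p ∣ m then (gaussNorm (m / p)).ncard else 0 := by
  have := Fact.mk hp
  have hP : Prime (p : GaussianInt) := GaussianInt.prime_of_nat_prime_of_mod_four_eq_three p h3
  have hp0 : (p : ℤ) ≠ 0 := by exact_mod_cast hp.ne_zero
  have key : ∀ z ∈ gaussNorm (p * m), ∃ w, z = p * w ∧ (p : ℤ) * Zsqrtd.norm w = m := by
    intro z hz
    have h1 : z * star z = p * m := by
      rw [← Zsqrtd.norm_eq_mul_conj, hz]; push_cast; rfl
    have h2 : (p : GaussianInt) ∣ z := by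
      rcases hP.dvd_or_dvd (⟨m, h1⟩ : (p : GaussianInt) ∣ z * star z) with h | h
      · exact h
      · simpa using gauss_star_dvd h
    obtain ⟨w, rfl⟩ := h2
    refine ⟨w, rfl, ?_⟩
    have h4 : Zsqrtd.norm ((p : GaussianInt) * w) = ((p * m : ℕ) : ℤ) := hz
    rw [Zsqrtd.norm_mul, Zsqrtd.norm_natCast] at h4
    push_cast at h4
    apply mul_left_cancel₀ hp0
    linarith
  split_ifs with h
  · obtain ⟨k, rfl⟩ := h
    rw [Nat.mul_div_cancel_left _ hp.pos, ← gauss_ncard_mul p hP.ne_zero (gaussNorm k)]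
    congr 1
    ext z
    constructor
    · intro hz
      obtain ⟨w, rfl, hw⟩ := key z hz
      refine ⟨w, ?_, rfl⟩
      push_cast at hw
      exact mul_left_cancel₀ hp0 hw
    · rintro ⟨w, hw, rfl⟩
      have hw' : Zsqrtd.norm w = k := hw
      simp only [gaussNorm, Set.mem_ofPred_eq, Zsqrtd.norm_mul, Zsqrtd.norm_natCast, hw']
      push_cast; ring
  · rw [Set.ncard_eq_zero (gaussNorm_finite _), Set.eq_empty_iff_forall_notMem]
    intro z hz
    obtain ⟨w, -, hw⟩ := key z hz
    exact h (Int.natCast_dvd_natCast.1 ⟨_, hw.symm⟩)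

lemma gauss_one {p : ℕ} (hp : p.Prime) (h1 : p % 4 = 1) (m : ℕ) :
    (gaussNorm (p * m)).ncard + (if p ∣ m then (gaussNorm (m / p)).ncard else 0)
      = 2 * (gaussNorm m).ncard := by
  have := Fact.mk hp
  obtain ⟨a, b, hab⟩ := Nat.Prime.sq_add_sq (p := p) (by omega)
  have hp0 : (p : ℤ) ≠ 0 := by exact_mod_cast hp.ne_zero
  obtain ⟨ϖ, hpr⟩ : ∃ ϖ : GaussianInt, ϖ = ⟨a, b⟩ := ⟨_, rfl⟩
  have hN : Zsqrtd.norm ϖ = (p : ℤ) := by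
    rw [hpr, Zsqrtd.norm_def, ← hab]; push_cast; ring
  have hN' : Zsqrtd.norm (star ϖ) = (p : ℤ) := by rw [Zsqrtd.norm_conj, hN]
  have hP := gauss_prime_of_norm hp hN
  have hP' := gauss_prime_of_norm hp hN'
  have hpp : ϖ * star ϖ = (p : GaussianInt) := by
    rw [← Zsqrtd.norm_eq_mul_conj, hN]; simp
  have hnd : ¬ ϖ ∣ star ϖ := by
    intro h
    have h2 : ϖ ∣ (⟨2 * a, 0⟩ : GaussianInt) := by
      have : (⟨2 * a, 0⟩ : GaussianInt) = ϖ + star ϖ := by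
        rw [hpr]; ext <;> simp <;> ring
      rw [this]
      exact dvd_add dvd_rfl h
    obtain ⟨c, hc⟩ := h2
    have h3 := congrArg Zsqrtd.norm hc
    rw [Zsqrtd.norm_mul, hN, Zsqrtd.norm_def] at h3
    have h4 : (p : ℤ) ∣ ((2 * a) * (2 * a) : ℕ) := ⟨_, by push_cast; linarith⟩
    have h5 : p ∣ (2 * a) * (2 * a) := by exact_mod_cast h4
    have h6 : p ∣ 2 * a := by rcases hp.dvd_mul.1 h5 with h | h <;> exact h
    have h7 : p ∣ a := by
      rcases hp.dvd_mul.1 h6 with h | h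
      · have := (Nat.prime_dvd_prime_iff_eq hp Nat.prime_two).1 h
        omega
      · exact h
    have h8 : p ∣ b := by
      have : p ∣ b ^ 2 := (Nat.dvd_add_right (dvd_pow h7 two_ne_zero)).1 (by rw [hab])
      exact hp.dvd_of_dvd_pow this
    obtain ⟨u, rfl⟩ := h7
    obtain ⟨v, rfl⟩ := h8
    have h9 : p * (p * (u ^ 2 + v ^ 2)) = p * 1 := by linarith
    have h10 := Nat.eq_of_mul_eq_mul_left hp.pos h9
    exact hp.one_lt.ne' (Nat.eq_one_of_mul_eq_one_right h10)
  have hU : gaussNorm (p * m) = (fun z => ϖ * z) '' gaussNorm m ∪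
      (fun z => star ϖ * z) '' gaussNorm m := by
    have aux : ∀ (q w : GaussianInt), Zsqrtd.norm q = (p : ℤ) →
        (q * w ∈ gaussNorm (p * m) ↔ w ∈ gaussNorm m) := by
      intro q w hq
      simp only [gaussNorm, Set.mem_ofPred_eq, Zsqrtd.norm_mul, hq]
      push_cast
      exact ⟨fun h => mul_left_cancel₀ hp0 h, fun h => by rw [h]⟩
    ext z
    constructor
    · intro hz
      have h1 : z * star z = p * m := by
        rw [← Zsqrtd.norm_eq_mul_conj, hz]; push_cast; rfl
      have h2 : ϖ ∣ z * star z := by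
        rw [h1, ← hpp, mul_assoc]; exact dvd_mul_right _ _
      rcases hP.dvd_or_dvd h2 with ⟨w, rfl⟩ | h
      · exact Or.inl ⟨w, (aux _ _ hN).1 hz, rfl⟩
      · obtain ⟨w, rfl⟩ := gauss_star_dvd h
        exact Or.inr ⟨w, (aux _ _ hN').1 hz, rfl⟩
    · rintro (⟨w, hw, rfl⟩ | ⟨w, hw, rfl⟩)
      · exact (aux _ _ hN).2 hw
      · exact (aux _ _ hN').2 hw
  have key : ∀ z ∈ (fun z => ϖ * z) '' gaussNorm m ∩ (fun z => star ϖ * z) '' gaussNorm m,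
      ∃ w, z = p * w ∧ (p : ℤ) * Zsqrtd.norm w = m := by
    rintro z ⟨⟨u, hu, rfl⟩, ⟨v, hv, hvu⟩⟩
    simp only at hvu
    have : ϖ ∣ star ϖ * v := ⟨u, hvu⟩
    rcases hP.dvd_or_dvd this with h | ⟨w, rfl⟩
    · exact absurd h hnd
    · refine ⟨w, ?_, ?_⟩
      · simp only
        rw [← hvu, ← hpp]; ring
      · have : Zsqrtd.norm (ϖ * w) = (m : ℤ) := hv
        rwa [Zsqrtd.norm_mul, hN] at this
  have hI : ((fun z => ϖ * z) '' gaussNorm m ∩ (fun z => star ϖ * z) '' gaussNorm m).ncard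
      = if p ∣ m then (gaussNorm (m / p)).ncard else 0 := by
    split_ifs with h
    · obtain ⟨k, rfl⟩ := h
      have hp0' : (p : GaussianInt) ≠ 0 := by exact_mod_cast hp.ne_zero
      rw [Nat.mul_div_cancel_left _ hp.pos, ← gauss_ncard_mul p hp0' (gaussNorm k)]
      congr 1
      ext z
      constructor
      · intro hz
        obtain ⟨w, rfl, hw⟩ := key z hz
        refine ⟨w, ?_, rfl⟩
        push_cast at hw
        exact mul_left_cancel₀ hp0 hw
      · rintro ⟨w, hw, rfl⟩
        have hw' : Zsqrtd.norm w = k := hw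
        refine ⟨⟨star ϖ * w, ?_, ?_⟩, ⟨ϖ * w, ?_, ?_⟩⟩
        · simp only [gaussNorm, Set.mem_ofPred_eq, Zsqrtd.norm_mul, hN', hw']
          push_cast; ring
        · simp only
          rw [← hpp]; ring
        · simp only [gaussNorm, Set.mem_ofPred_eq, Zsqrtd.norm_mul, hN, hw']
          push_cast; ring
        · simp only
          rw [← hpp]; ring
    · rw [Set.ncard_eq_zero (((gaussNorm_finite _).image _).inter_of_left _),
        Set.eq_empty_iff_forall_notMem]
      intro z hz
      obtain ⟨w, -, hw⟩ := key z hz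
      exact h (Int.natCast_dvd_natCast.1 ⟨_, hw.symm⟩)
  rw [← hI, hU, Set.ncard_union_add_ncard_inter _ _ ((gaussNorm_finite _).image _)
    ((gaussNorm_finite _).image _), gauss_ncard_mul _ hP.ne_zero, gauss_ncard_mul _ hP'.ne_zero]
  ring

lemma hecke_gauss : HeckeRec (fun m => ((gaussNorm m).ncard : ℤ)) := by
  intro p m hp hm
  simp only
  rw [ZMod.χ₄_nat_eq_if_mod_four]
  rcases hp.eq_two_or_odd with rfl | hodd
  · simp [gauss_two]
  · rw [if_neg (by omega)]
    by_cases h1 : p % 4 = 1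
    · rw [if_pos h1]
      have := gauss_one hp h1 m
      have h2 := congrArg (Nat.cast : ℕ → ℤ) this
      push_cast at h2
      linarith
    · rw [if_neg h1, gauss_three hp (by omega) m]
      push_cast
      ring

lemma gaussNorm_one : (gaussNorm 1).ncard = 4 := by
  have : gaussNorm 1 = (({⟨1, 0⟩, ⟨-1, 0⟩, ⟨0, 1⟩, ⟨0, -1⟩} : Finset GaussianInt) :
      Set GaussianInt) := by
    ext ⟨x, y⟩
    rw [gaussNorm_iff]
    simp only [Finset.coe_insert, Finset.coe_singleton, Set.mem_insert_iff,
      Set.mem_singleton_iff, Zsqrtd.ext_iff]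
    constructor
    · intro h
      push_cast at h
      have hx : x ≤ 1 := by nlinarith [sq_nonneg y]
      have hx' : -1 ≤ x := by nlinarith [sq_nonneg y]
      have hy : y ≤ 1 := by nlinarith [sq_nonneg x]
      have hy' : -1 ≤ y := by nlinarith [sq_nonneg x]
      interval_cases x <;> interval_cases y <;> simp_all
    · rintro (⟨rfl, rfl⟩ | ⟨rfl, rfl⟩ | ⟨rfl, rfl⟩ | ⟨rfl, rfl⟩) <;> norm_num
  rw [this, Set.ncard_coe_finset]
  decide

lemma jacobi_two (m : ℕ) (hm : 0 < m) : ((gaussNorm m).ncard : ℤ) = 4 * chiSum m := by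
  refine hecke_unique _ _ hecke_gauss hecke_chiSum 4 ?_ m hm
  simp [gaussNorm_one, chiSum]

lemma approx_reflect_left (n : ℕ) (i j : ℤ) (h : (i, j) ∈ approx n unitCircle) :
    (-1 - i, j) ∈ approx n unitCircle := by
  obtain ⟨⟨x, y⟩, ⟨h1, h2, h3, h4⟩, h5⟩ := h
  simp only at h1 h2 h3 h4
  refine ⟨(-x, y), ⟨?_, ?_, h3, h4⟩, ?_⟩
  · simp only
    have : ((-1 - i : ℤ) : ℝ) / n = -(((i : ℝ) + 1) / n) := by push_cast; ring
    rw [this]; linarith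
  · simp only
    have : (((-1 - i : ℤ) : ℝ) + 1) / n = -((i : ℝ) / n) := by push_cast; ring
    rw [this]; linarith
  · have h6 : x ^ 2 + y ^ 2 = 1 := h5
    change (-x) ^ 2 + y ^ 2 = 1
    linarith [neg_sq x]

lemma approx_swap (n : ℕ) (i j : ℤ) (h : (i, j) ∈ approx n unitCircle) :
    (j, i) ∈ approx n unitCircle := by
  obtain ⟨⟨x, y⟩, ⟨h1, h2, h3, h4⟩, h5⟩ := h
  refine ⟨(y, x), ⟨h3, h4, h1, h2⟩, ?_⟩
  have h6 : x ^ 2 + y ^ 2 = 1 := h5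
  change y ^ 2 + x ^ 2 = 1
  linarith

lemma approx_left_iff (n : ℕ) (i j : ℤ) :
    (-1 - i, j) ∈ approx n unitCircle ↔ (i, j) ∈ approx n unitCircle := by
  refine ⟨fun h => ?_, approx_reflect_left n i j⟩
  have := approx_reflect_left n _ _ h
  rwa [sub_sub_cancel] at this

lemma approx_right_iff (n : ℕ) (i j : ℤ) :
    (i, -1 - j) ∈ approx n unitCircle ↔ (i, j) ∈ approx n unitCircle :=
  ⟨fun h => approx_swap _ _ _ ((approx_left_iff n j i).1 (approx_swap _ _ _ h)),
   fun h => approx_swap _ _ _ ((approx_left_iff n j i).2 (approx_swap _ _ _ h))⟩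

lemma approx_quadrant (n : ℕ) (hn : 1 ≤ n) (a b : ℕ) :
    ((a : ℤ), (b : ℤ)) ∈ approx n unitCircle ↔
      a ^ 2 + b ^ 2 < n ^ 2 ∧ n ^ 2 < (a + 1) ^ 2 + (b + 1) ^ 2 := by
  have hn0 : (0 : ℝ) < n := by exact_mod_cast hn
  have ha0 : (0 : ℝ) ≤ a := Nat.cast_nonneg a
  have hb0 : (0 : ℝ) ≤ b := Nat.cast_nonneg b
  constructor
  · rintro ⟨⟨x, y⟩, ⟨h1, h2, h3, h4⟩, h5⟩
    have h6 : x ^ 2 + y ^ 2 = 1 := h5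
    simp only [Int.cast_natCast] at h1 h2 h3 h4
    rw [div_lt_iff₀ hn0] at h1 h3
    rw [lt_div_iff₀ hn0] at h2 h4
    have h7 : (x * n) ^ 2 + (y * n) ^ 2 = (n : ℝ) ^ 2 := by
      linear_combination (n : ℝ) ^ 2 * h6
    have e1 := pow_lt_pow_left₀ h1 ha0 two_ne_zero
    have e2 := pow_lt_pow_left₀ h3 hb0 two_ne_zero
    have e3 := pow_lt_pow_left₀ h2 (ha0.trans h1.le) two_ne_zero
    have e4 := pow_lt_pow_left₀ h4 (hb0.trans h3.le) two_ne_zero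
    constructor
    · have : (a : ℝ) ^ 2 + (b : ℝ) ^ 2 < (n : ℝ) ^ 2 := by linarith
      exact_mod_cast this
    · have : (n : ℝ) ^ 2 < ((a : ℝ) + 1) ^ 2 + ((b : ℝ) + 1) ^ 2 := by linarith
      exact_mod_cast this
  · rintro ⟨h1, h2⟩
    have h1' : (a : ℝ) ^ 2 + (b : ℝ) ^ 2 < (n : ℝ) ^ 2 := by exact_mod_cast h1
    have h2' : (n : ℝ) ^ 2 < ((a : ℝ) + 1) ^ 2 + ((b : ℝ) + 1) ^ 2 := by exact_mod_cast h2
    have hc : ContinuousOn (fun t : ℝ => ((a : ℝ) + t) ^ 2 + ((b : ℝ) + t) ^ 2) (Set.Icc 0 1) := by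
      fun_prop
    obtain ⟨t, ⟨ht0, ht1⟩, ht⟩ := intermediate_value_Ioo zero_le_one hc
      (show (n : ℝ) ^ 2 ∈ _ from ⟨by simpa using h1', h2'⟩)
    simp only at ht
    refine ⟨(((a : ℝ) + t) / n, ((b : ℝ) + t) / n), ⟨?_, ?_, ?_, ?_⟩, ?_⟩
    · simp only [Int.cast_natCast]; gcongr; linarith
    · simp only [Int.cast_natCast]; gcongr
    · simp only [Int.cast_natCast]; gcongr; linarith
    · simp only [Int.cast_natCast]; gcongr
    · change (((a : ℝ) + t) / n) ^ 2 + (((b : ℝ) + t) / n) ^ 2 = 1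
      rw [div_pow, div_pow, ← add_div, ht]
      exact div_self (by positivity)

/-- Boxes in the first quadrant meeting the circle. -/
def quadBoxes (n : ℕ) : Finset (ℕ × ℕ) :=
  (Finset.range n ×ˢ Finset.range n).filter
    (fun q => q.1 ^ 2 + q.2 ^ 2 < n ^ 2 ∧ n ^ 2 < (q.1 + 1) ^ 2 + (q.2 + 1) ^ 2)

/-- Interior first-quadrant lattice points on the circle, shifted by one. -/
def quadPts (n : ℕ) : Finset (ℕ × ℕ) :=
  (Finset.range n ×ˢ Finset.range n).filter
    (fun q => (q.1 + 1) ^ 2 + (q.2 + 1) ^ 2 = n ^ 2)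

/-- Signed version of a natural number: `a` or `-1 - a`. -/
def sgnNat (q : Bool × ℕ) : ℤ := if q.1 then (q.2 : ℤ) else -1 - (q.2 : ℤ)

lemma sgnNat_inj : Function.Injective sgnNat := by
  rintro ⟨s, a⟩ ⟨t, b⟩ h
  cases s <;> cases t <;> simp [sgnNat] at h ⊢ <;> omega

lemma sgnNat_surj (x : ℤ) : ∃ q, sgnNat q = x := by
  by_cases h : 0 ≤ x
  · exact ⟨(true, x.toNat), by simp [sgnNat, h]⟩
  · exact ⟨(false, (-1 - x).toNat), by simp [sgnNat]; omega⟩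

lemma approx_ncard (n : ℕ) (hn : 1 ≤ n) :
    (approx n unitCircle).ncard = 4 * (quadBoxes n).card := by
  have hset : approx n unitCircle =
      (((Finset.univ : Finset (Bool × Bool)) ×ˢ quadBoxes n : Finset _) : Set _).image
        (fun q : (Bool × Bool) × (ℕ × ℕ) => (sgnNat (q.1.1, q.2.1), sgnNat (q.1.2, q.2.2))) := by
    have key : ∀ s t a b, (sgnNat (s, a), sgnNat (t, b)) ∈ approx n unitCircle ↔
        (a, b) ∈ quadBoxes n := by
      intro s t a b
      have h1 : (sgnNat (s, a), sgnNat (t, b)) ∈ approx n unitCircle ↔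
          ((a : ℤ), (b : ℤ)) ∈ approx n unitCircle := by
        cases s <;> cases t <;> simp [sgnNat, approx_left_iff, approx_right_iff]
      rw [h1, approx_quadrant n hn]
      simp only [quadBoxes, Finset.mem_filter, Finset.mem_product, Finset.mem_range]
      refine ⟨fun h => ⟨⟨?_, ?_⟩, h⟩, fun h => h.2⟩
      · exact lt_of_pow_lt_pow_left₀ 2 (Nat.zero_le _) (by nlinarith [h.1])
      · exact lt_of_pow_lt_pow_left₀ 2 (Nat.zero_le _) (by nlinarith [h.1])
    ext ⟨x, y⟩
    obtain ⟨⟨s, a⟩, rfl⟩ := sgnNat_surj x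
    obtain ⟨⟨t, b⟩, rfl⟩ := sgnNat_surj y
    rw [key]
    constructor
    · intro h
      exact ⟨((s, t), (a, b)), by simpa using h, rfl⟩
    · rintro ⟨⟨⟨s', t'⟩, ⟨a', b'⟩⟩, hq, he⟩
      simp only [Prod.mk.injEq] at he
      have e1 := sgnNat_inj he.1
      have e2 := sgnNat_inj he.2
      simp only [Prod.mk.injEq] at e1 e2
      obtain ⟨rfl, rfl⟩ := e1
      obtain ⟨rfl, rfl⟩ := e2
      simpa using hq
  rw [hset, Set.ncard_image_of_injective, Set.ncard_coe_finset, Finset.card_product]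
  · simp
  · rintro ⟨⟨s, t⟩, ⟨a, b⟩⟩ ⟨⟨s', t'⟩, ⟨a', b'⟩⟩ he
    simp only [Prod.mk.injEq] at he
    have e1 := sgnNat_inj he.1
    have e2 := sgnNat_inj he.2
    simp only [Prod.mk.injEq] at e1 e2 ⊢
    tauto

/-- Nonzero integers: `a + 1` or `-(a + 1)`. -/
def sgnPos (q : Bool × ℕ) : ℤ := if q.1 then (q.2 : ℤ) + 1 else -((q.2 : ℤ) + 1)

lemma sgnPos_inj : Function.Injective sgnPos := by
  rintro ⟨s, a⟩ ⟨t, b⟩ h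
  cases s <;> cases t <;> simp [sgnPos] at h ⊢ <;> omega

lemma sgnPos_surj (x : ℤ) (hx : x ≠ 0) : ∃ q, sgnPos q = x := by
  by_cases h : 0 < x
  · exact ⟨(true, (x - 1).toNat), by simp [sgnPos]; omega⟩
  · exact ⟨(false, (-1 - x).toNat), by simp [sgnPos]; omega⟩

lemma sgnPos_ne (q : Bool × ℕ) : sgnPos q ≠ 0 := by
  obtain ⟨s, a⟩ := q
  cases s <;> simp [sgnPos] <;> omega

lemma sgnPos_sq (s : Bool) (a : ℕ) : sgnPos (s, a) ^ 2 = ((a : ℤ) + 1) ^ 2 := by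
  cases s <;> simp [sgnPos]; ring

lemma gauss_ncard_quad (n : ℕ) (hn : 1 ≤ n) :
    (gaussNorm (n ^ 2)).ncard = 4 + 4 * (quadPts n).card := by
  have hn0 : (n : ℤ) ≠ 0 := by exact_mod_cast (by omega : n ≠ 0)
  have hset : gaussNorm (n ^ 2) =
      (({⟨n, 0⟩, ⟨-n, 0⟩, ⟨0, n⟩, ⟨0, -n⟩} : Finset GaussianInt) : Set GaussianInt) ∪
      (((Finset.univ : Finset (Bool × Bool)) ×ˢ quadPts n : Finset _) : Set _).image
        (fun q : (Bool × Bool) × (ℕ × ℕ) =>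
          (⟨sgnPos (q.1.1, q.2.1), sgnPos (q.1.2, q.2.2)⟩ : GaussianInt)) := by
    ext ⟨x, y⟩
    rw [gaussNorm_iff]
    simp only [Finset.coe_insert, Finset.coe_singleton, Set.mem_union, Set.mem_insert_iff,
      Set.mem_singleton_iff, Zsqrtd.ext_iff, Set.mem_image]
    push_cast
    constructor
    · intro h
      by_cases hx : x = 0
      · subst hx
        have : y ^ 2 = (n : ℤ) ^ 2 := by linarith
        rcases sq_eq_sq_iff_eq_or_eq_neg.1 this with rfl | rfl <;> simp
      by_cases hy : y = 0
      · subst hy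
        have : x ^ 2 = (n : ℤ) ^ 2 := by linarith
        rcases sq_eq_sq_iff_eq_or_eq_neg.1 this with rfl | rfl <;> simp
      right
      obtain ⟨⟨s, a⟩, rfl⟩ := sgnPos_surj x hx
      obtain ⟨⟨t, b⟩, rfl⟩ := sgnPos_surj y hy
      refine ⟨((s, t), (a, b)), ?_, rfl, rfl⟩
      rw [sgnPos_sq, sgnPos_sq] at h
      have h' : (a + 1) ^ 2 + (b + 1) ^ 2 = n ^ 2 := by exact_mod_cast h
      have ha : a < n := lt_of_pow_lt_pow_left₀ 2 (Nat.zero_le _)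
        (by nlinarith [a.zero_le, b.zero_le, sq_nonneg b])
      have hb : b < n := lt_of_pow_lt_pow_left₀ 2 (Nat.zero_le _)
        (by nlinarith [a.zero_le, b.zero_le, sq_nonneg a])
      simp [quadPts, ha, hb, h']
    · rintro ((⟨rfl, rfl⟩ | ⟨rfl, rfl⟩ | ⟨rfl, rfl⟩ | ⟨rfl, rfl⟩) |
        ⟨⟨⟨s, t⟩, ⟨a, b⟩⟩, hq, rfl, rfl⟩)
      · ring
      · ring
      · ring
      · ring
      · simp only [quadPts, Finset.coe_product, Finset.coe_univ, Set.mem_prod, Set.mem_univ,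
          true_and, Finset.mem_coe, Finset.mem_filter] at hq
        simp only [sgnPos_sq]
        exact_mod_cast hq.2
  have hdisj : Disjoint
      (({⟨n, 0⟩, ⟨-n, 0⟩, ⟨0, n⟩, ⟨0, -n⟩} : Finset GaussianInt) : Set GaussianInt)
      ((((Finset.univ : Finset (Bool × Bool)) ×ˢ quadPts n : Finset _) : Set _).image
        (fun q : (Bool × Bool) × (ℕ × ℕ) =>
          (⟨sgnPos (q.1.1, q.2.1), sgnPos (q.1.2, q.2.2)⟩ : GaussianInt))) := by
    rw [Set.disjoint_right]
    rintro _ ⟨⟨⟨s, t⟩, ⟨a, b⟩⟩, -, rfl⟩ h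
    simp only [Finset.coe_insert, Finset.coe_singleton, Set.mem_insert_iff,
      Set.mem_singleton_iff, Zsqrtd.ext_iff] at h
    have h1 := sgnPos_ne (s, a)
    have h2 := sgnPos_ne (t, b)
    tauto
  rw [hset, Set.ncard_union_eq hdisj (Finset.finite_toSet _) ((Finset.finite_toSet _).image _),
    Set.ncard_image_of_injective, Set.ncard_coe_finset, Set.ncard_coe_finset, Finset.card_product]
  · congr 1
    have e1 : (n : ℤ) ≠ -n := by omega
    have e2 : (0 : ℤ) ≠ n := by omega
    have e3 : (0 : ℤ) ≠ -n := by omega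
    rw [Finset.card_insert_of_notMem, Finset.card_insert_of_notMem,
      Finset.card_insert_of_notMem, Finset.card_singleton] <;>
    simp only [Finset.mem_insert, Finset.mem_singleton, Zsqrtd.ext_iff] <;> omega
  · rintro ⟨⟨s, t⟩, ⟨a, b⟩⟩ ⟨⟨s', t'⟩, ⟨a', b'⟩⟩ he
    simp only [Zsqrtd.ext_iff] at he
    have e1 := sgnPos_inj he.1
    have e2 := sgnPos_inj he.2
    simp only [Prod.mk.injEq] at e1 e2 ⊢
    tauto

lemma quad_count (n : ℕ) (hn : 1 ≤ n) :
    (quadBoxes n).card + (quadPts n).card + 1 = 2 * n := by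
  set G := Finset.range n ×ˢ Finset.range n with hG
  -- all boxes whose lower corner is inside
  set A := G.filter (fun q => q.1 ^ 2 + q.2 ^ 2 < n ^ 2) with hA
  set B := G.filter (fun q => (q.1 + 1) ^ 2 + (q.2 + 1) ^ 2 ≤ n ^ 2) with hB
  set B' := G.filter (fun q => (q.1 + 1) ^ 2 + (q.2 + 1) ^ 2 < n ^ 2) with hB'
  have h1 : A.card = (quadBoxes n).card + B.card := by
    rw [← Finset.card_filter_add_card_filter_not (s := A)
      (fun q => n ^ 2 < (q.1 + 1) ^ 2 + (q.2 + 1) ^ 2)]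
    congr 2
    · rw [hA, Finset.filter_filter]; rfl
    · ext q
      simp only [hA, hB, Finset.mem_filter, not_lt]
      constructor
      · tauto
      · rintro ⟨h, h'⟩
        exact ⟨⟨h, by nlinarith [q.1.zero_le, q.2.zero_le]⟩, h'⟩
  have h2 : B.card = B'.card + (quadPts n).card := by
    rw [← Finset.card_filter_add_card_filter_not (s := B)
      (fun q => (q.1 + 1) ^ 2 + (q.2 + 1) ^ 2 < n ^ 2)]
    congr 2
    · ext q
      simp only [hB', hB, Finset.mem_filter]
      constructor
      · tauto
      · rintro ⟨h, h'⟩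
        exact ⟨⟨h, h'.le⟩, h'⟩
    · ext q
      simp only [hB, quadPts, ← hG, Finset.mem_filter, not_lt]
      constructor
      · rintro ⟨⟨h, h'⟩, h''⟩
        exact ⟨h, le_antisymm h' h''⟩
      · rintro ⟨h, h'⟩
        exact ⟨⟨h, h'.le⟩, h'.ge⟩
  have h3 : A = (B'.image (fun q => (q.1 + 1, q.2 + 1))) ∪
      ((Finset.range n).image (fun a => (a, 0)) ∪
        (Finset.range (n - 1)).image (fun b => (0, b + 1))) := by
    ext ⟨a, b⟩
    simp only [hA, hB', hG, Finset.mem_filter, Finset.mem_union, Finset.mem_image,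
      Finset.mem_product, Finset.mem_range, Prod.mk.injEq, Prod.exists]
    constructor
    · rintro ⟨⟨ha, hb⟩, h⟩
      rcases b with _ | b
      · exact Or.inr (Or.inl ⟨a, ha, rfl, rfl⟩)
      rcases a with _ | a
      · exact Or.inr (Or.inr ⟨b, by omega, rfl, rfl⟩)
      exact Or.inl ⟨a, b, ⟨⟨by omega, by omega⟩, h⟩, rfl, rfl⟩
    · rintro (⟨a', b', ⟨⟨ha, hb⟩, h⟩, rfl, rfl⟩ | ⟨a', ha, rfl, rfl⟩ | ⟨b', hb, rfl, rfl⟩)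
      · refine ⟨⟨?_, ?_⟩, h⟩
        · exact lt_of_pow_lt_pow_left₀ 2 (Nat.zero_le _) (by nlinarith)
        · exact lt_of_pow_lt_pow_left₀ 2 (Nat.zero_le _) (by nlinarith)
      · exact ⟨⟨ha, hn⟩, by nlinarith⟩
      · have : b' + 1 < n := by omega
        exact ⟨⟨hn, this⟩, by nlinarith⟩
  have h4 : A.card = B'.card + (n + (n - 1)) := by
    rw [h3, Finset.card_union_of_disjoint, Finset.card_union_of_disjoint,
      Finset.card_image_of_injective, Finset.card_image_of_injective,
      Finset.card_image_of_injective, Finset.card_range, Finset.card_range]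
    · intro x y h; simpa using h
    · intro x y h; simpa using h
    · rintro ⟨a, b⟩ ⟨c, d⟩ h; simpa using h
    · rw [Finset.disjoint_left]
      rintro ⟨a, b⟩ h h'
      simp only [Finset.mem_image, Prod.mk.injEq] at h h'
      obtain ⟨_, _, _, h5⟩ := h
      obtain ⟨_, _, _, h6⟩ := h'
      omega
    · rw [Finset.disjoint_left]
      rintro ⟨a, b⟩ h h'
      simp only [Finset.mem_image, Finset.mem_union, Prod.mk.injEq] at h h'
      obtain ⟨_, _, h5, h6⟩ := h
      obtain ⟨_, _, h7, h8⟩ | ⟨_, _, h7, h8⟩ := h' <;> omega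
  omega

theorem card_approx_unitCircle (n : ℕ) (hn : 1 ≤ n) :
    ((approx n unitCircle).ncard : ℤ) =
      8 * n - 4 * ∑ d ∈ (n ^ 2).divisors.filter (fun d => Odd d), (-1 : ℤ) ^ ((d - 1) / 2) := by
  rw [chiSum_eq, ← jacobi_two (n ^ 2) (by positivity), gauss_ncard_quad n hn, approx_ncard n hn]
  have := quad_count n hn
  push_cast
  omega
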